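/- Fix parameters α_0,…,α_5 with α_0+α_1+α_2+α_3+α_4+α_5 = 1 and fix i ∈ {0,…,5}. If (f_0,…,f_5) and (g_0,…,g_5) are both rational solutions of A_5(α_0,…,α_5) such that f_i, f_{i+1}, f_{i+2}, f_{i+3} (respectively g_i, g_{i+1}, g_{i+2}, g_{i+3}) have a pole at t=∞ and the remaining two components are holomorphic at t=∞, then f_j = g_j for all j = 0,…,5. -/

import Mathlib

open Filter Topology Polynomial

noncomputable section

/-- Evaluation of a complex rational function at a point (junk value where the
reduced denominator vanishes). -/
def evalR (f : RatFunc ℂ) (t : ℂ) : ℂ := RatFunc.eval (RingHom.id ℂ) t f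

/-- `f` is defined at `t`: the reduced denominator does not vanish at `t`. -/
def DefinedAt (f : RatFunc ℂ) (t : ℂ) : Prop := Polynomial.eval t (RatFunc.denom f) ≠ 0

/-- `(f 0, …, f 5)` is a rational solution of the `A₅⁽¹⁾` Painlevé system `A₅(α)`:
the two constraints hold identically as rational functions, and the six ODEs hold at
every point where all six components are defined.  (Indices are taken in `Fin 6`,
i.e. modulo `6`.) -/
def IsA5Solution (α : Fin 6 → ℂ) (f : Fin 6 → RatFunc ℂ) : Prop :=
  f 0 + f 2 + f 4 = RatFunc.X ∧
  f 1 + f 3 + f 5 = RatFunc.X ∧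
  ∀ t : ℂ, (∀ j : Fin 6, DefinedAt (f j) t) → ∀ i : Fin 6,
    t / 2 * deriv (evalR (f i)) t =
      evalR (f i) t *
        (evalR (f (i + 1)) t * evalR (f (i + 2)) t
          + evalR (f (i + 1)) t * evalR (f (i + 4)) t
          + evalR (f (i + 3)) t * evalR (f (i + 4)) t
          - evalR (f (i + 2)) t * evalR (f (i + 3)) t
          - evalR (f (i + 2)) t * evalR (f (i + 5)) t
          - evalR (f (i + 4)) t * evalR (f (i + 5)) t)
      + (1 / 2 - α (i + 2) - α (i + 4)) * evalR (f i) t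
      + α i * (evalR (f (i + 2)) t + evalR (f (i + 4)) t)

/-- `f` has a pole at `t = ∞`: `‖f t‖ → ∞` as `‖t‖ → ∞`. -/
def PoleAtInfty (f : RatFunc ℂ) : Prop :=
  Tendsto (fun t => ‖evalR f t‖) (Bornology.cobounded ℂ) atTop

/-- `f` is holomorphic at `t = ∞`: `f` is bounded as `‖t‖ → ∞`. -/
def HoloAtInfty (f : RatFunc ℂ) : Prop :=
  IsBoundedUnder (· ≤ ·) (Bornology.cobounded ℂ) fun t => ‖evalR f t‖

/-- `f` has a pole at `c ∈ ℂ`: `‖f t‖ → ∞` as `t → c`. -/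
def PoleAt (f : RatFunc ℂ) (c : ℂ) : Prop :=
  Tendsto (fun t => ‖evalR f t‖) (𝓝[≠] c) atTop

/-- `f` is regular at `c ∈ ℂ`: it extends continuously to `c`. -/
def RegularAt (f : RatFunc ℂ) (c : ℂ) : Prop :=
  ∃ L : ℂ, Tendsto (fun t => evalR f t) (𝓝[≠] c) (𝓝 L)

/-- `z` is an integer. -/
def IsInt (z : ℂ) : Prop := ∃ n : ℤ, z = (n : ℂ)

/-- `z` is an even integer. -/
def IsEvenInt (z : ℂ) : Prop := ∃ n : ℤ, z = 2 * (n : ℂ)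

/-- A tuple of rational functions has pole configuration of Type A at `t = ∞`. -/
def TypeA (f : Fin 6 → RatFunc ℂ) : Prop :=
  ∃ i : Fin 6,
    (PoleAtInfty (f i) ∧ PoleAtInfty (f (i + 1)) ∧ HoloAtInfty (f (i + 2)) ∧
      HoloAtInfty (f (i + 3)) ∧ HoloAtInfty (f (i + 4)) ∧ HoloAtInfty (f (i + 5))) ∨
    (PoleAtInfty (f i) ∧ PoleAtInfty (f (i + 3)) ∧ HoloAtInfty (f (i + 1)) ∧
      HoloAtInfty (f (i + 2)) ∧ HoloAtInfty (f (i + 4)) ∧ HoloAtInfty (f (i + 5))) ∨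
    (PoleAtInfty (f i) ∧ PoleAtInfty (f (i + 1)) ∧ PoleAtInfty (f (i + 2)) ∧
      PoleAtInfty (f (i + 4)) ∧ HoloAtInfty (f (i + 3)) ∧ HoloAtInfty (f (i + 5)))

/-- A tuple of rational functions has pole configuration of Type B at `t = ∞`. -/
def TypeB (f : Fin 6 → RatFunc ℂ) : Prop :=
  ∃ i : Fin 6,
    PoleAtInfty (f i) ∧ PoleAtInfty (f (i + 1)) ∧ PoleAtInfty (f (i + 2)) ∧
    PoleAtInfty (f (i + 3)) ∧ HoloAtInfty (f (i + 4)) ∧ HoloAtInfty (f (i + 5))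
open Asymptotics Bornology

/-- A nonzero complex polynomial has no zeros near infinity. -/
lemma eventually_eval_ne_zero {p : ℂ[X]} (hp : p ≠ 0) :
    ∀ᶠ t in cobounded ℂ, p.eval t ≠ 0 := by
  exact Bornology.le_cofinite ℂ (Polynomial.eventually_cofinite_not_isRoot hp)

lemma eventually_definedAt (f : RatFunc ℂ) : ∀ᶠ t in cobounded ℂ, DefinedAt f t :=
  eventually_eval_ne_zero f.denom_ne_zero

lemma evalR_eq_div (f : RatFunc ℂ) (t : ℂ) : evalR f t = f.num.eval t / f.denom.eval t := by
  simp [evalR, RatFunc.eval, Polynomial.eval₂_id]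

lemma evalR_add {f g : RatFunc ℂ} {t : ℂ} (hf : DefinedAt f t) (hg : DefinedAt g t) :
    evalR (f + g) t = evalR f t + evalR g t :=
  RatFunc.eval_add _ _ (by simpa [DefinedAt, Polynomial.eval₂_id] using hf)
    (by simpa [DefinedAt, Polynomial.eval₂_id] using hg)

lemma evalR_sub_eventually (f g : RatFunc ℂ) :
    ∀ᶠ t in cobounded ℂ, evalR (f - g) t = evalR f t - evalR g t := by
  filter_upwards [eventually_definedAt (f - g), eventually_definedAt g] with t h₁ h₂
  have := evalR_add h₁ h₂
  rw [sub_add_cancel] at this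
  rw [this, add_sub_cancel_right]

lemma isOpen_definedAt (f : RatFunc ℂ) : IsOpen {t | DefinedAt f t} :=
  isOpen_ne_fun f.denom.continuous continuous_const

lemma hasDerivAt_evalR {f : RatFunc ℂ} {t : ℂ} (ht : DefinedAt f t) :
    HasDerivAt (evalR f)
      ((f.num.derivative.eval t * f.denom.eval t - f.num.eval t * f.denom.derivative.eval t)
        / f.denom.eval t ^ 2) t := by
  have h := (f.num.hasDerivAt t).div (f.denom.hasDerivAt t) ht
  exact h.congr_of_eventuallyEq (Eventually.of_forall fun s => evalR_eq_div f s)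

lemma deriv_evalR_sub_eventually (f g : RatFunc ℂ) :
    ∀ᶠ t in cobounded ℂ,
      deriv (evalR (f - g)) t = deriv (evalR f) t - deriv (evalR g) t := by
  filter_upwards [eventually_definedAt (f - g), eventually_definedAt f, eventually_definedAt g]
    with t h₁ h₂ h₃
  have heq : evalR f =ᶠ[𝓝 t] fun s => evalR (f - g) s + evalR g s := by
    filter_upwards [(isOpen_definedAt _).mem_nhds h₁, (isOpen_definedAt _).mem_nhds h₃]
      with s k₁ k₃
    rw [← evalR_add k₁ k₃, sub_add_cancel]
  rw [heq.deriv_eq, deriv_fun_add (hasDerivAt_evalR h₁).differentiableAt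
    (hasDerivAt_evalR h₃).differentiableAt, add_sub_cancel_right]

/-- A rational function vanishing near infinity is zero. -/
lemma eq_zero_of_evalR_eventually_eq_zero {f : RatFunc ℂ}
    (h : ∀ᶠ t in cobounded ℂ, evalR f t = 0) : f = 0 := by
  by_contra hf
  obtain ⟨t, h₀, h₁, h₂⟩ := (h.and ((eventually_eval_ne_zero (RatFunc.num_ne_zero hf)).and
    (eventually_definedAt f))).exists
  rw [evalR_eq_div] at h₀
  exact div_ne_zero h₁ h₂ h₀

lemma isBigO_id_mul_derivative (p : ℂ[X]) :
    (fun t => t * p.derivative.eval t) =O[cobounded ℂ] fun t => p.eval t := by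
  have h : (X * derivative p).degree ≤ p.degree := by
    by_cases hp : derivative p = 0
    · simp [hp]
    · rw [degree_mul, degree_X, add_comm]
      have := degree_derivative_lt (p := p) (by rintro rfl; simp at hp)
      exact Nat.WithBot.add_one_le_of_lt this
  simpa using Polynomial.isBigO_cobounded_of_degree_le h

/-- The Euler derivation does not increase the growth of a rational function at infinity. -/
lemma isBigO_id_mul_deriv_evalR (f : RatFunc ℂ) :
    (fun t => t / 2 * deriv (evalR f) t) =O[cobounded ℂ] evalR f := by
  have h₁ : (fun t => (t * f.num.derivative.eval t) * (1 / f.denom.eval t))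
      =O[cobounded ℂ] fun t => f.num.eval t * (1 / f.denom.eval t) :=
    (isBigO_id_mul_derivative f.num).mul (isBigO_refl _ _)
  have h₂ : (fun t => (t * f.denom.derivative.eval t) * (f.num.eval t / f.denom.eval t ^ 2))
      =O[cobounded ℂ] fun t => f.denom.eval t * (f.num.eval t / f.denom.eval t ^ 2) :=
    (isBigO_id_mul_derivative f.denom).mul (isBigO_refl _ _)
  have e₁ : (fun t => f.num.eval t * (1 / f.denom.eval t)) =ᶠ[cobounded ℂ] evalR f :=
    Eventually.of_forall fun t => by simp only [evalR_eq_div]; ring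
  have e₂ : (fun t => f.denom.eval t * (f.num.eval t / f.denom.eval t ^ 2))
      =ᶠ[cobounded ℂ] evalR f := by
    filter_upwards [eventually_definedAt f] with t ht
    have ht' : f.denom.eval t ≠ 0 := ht
    rw [evalR_eq_div]
    field_simp
  refine (((h₁.trans_eventuallyEq e₁).sub (h₂.trans_eventuallyEq e₂)).const_mul_left
    (1 / 2)).congr' ?_ EventuallyEq.rfl
  filter_upwards [eventually_definedAt f] with t ht
  have ht' : f.denom.eval t ≠ 0 := ht
  rw [(hasDerivAt_evalR ht).deriv]
  field_simp

/-- A rational function with a pole at infinity grows at least linearly. -/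
lemma PoleAtInfty.isBigO_id {f : RatFunc ℂ} (hf : PoleAtInfty f) :
    (fun t : ℂ => t) =O[cobounded ℂ] evalR f := by
  have hdeg : ¬ f.num.degree ≤ f.denom.degree := by
    intro hle
    have h₁ : evalR f =O[cobounded ℂ] fun _ => (1 : ℂ) := by
      refine ((Polynomial.isBigO_cobounded_of_degree_le hle).mul
        (isBigO_refl (fun t => (f.denom.eval t)⁻¹) _)).congr' ?_ ?_
      · exact Eventually.of_forall fun t => by simp only [evalR_eq_div]; rfl
      · filter_upwards [eventually_definedAt f] with t ht using mul_inv_cancel₀ ht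
    exact (not_isBoundedUnder_of_tendsto_atTop hf) h₁.isBoundedUnder_le
  have hle : (X * f.denom).degree ≤ f.num.degree := by
    rw [degree_mul, degree_X, add_comm]
    exact Nat.WithBot.add_one_le_of_lt (not_le.mp hdeg)
  refine ((Polynomial.isBigO_cobounded_of_degree_le hle).mul
    (isBigO_refl (fun t => (f.denom.eval t)⁻¹) _)).congr' ?_ ?_
  · filter_upwards [eventually_definedAt f] with t ht
    have ht' : f.denom.eval t ≠ 0 := ht
    simp [ht']
  · exact Eventually.of_forall fun t => by simp only [evalR_eq_div]; rfl

lemma HoloAtInfty.isBigO_one {f : RatFunc ℂ} (hf : HoloAtInfty f) :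
    evalR f =O[cobounded ℂ] fun _ => (1 : ℂ) :=
  IsBoundedUnder.isBigO_one ℂ hf

lemma eventually_id_ne_zero : ∀ᶠ t : ℂ in cobounded ℂ, t ≠ 0 :=
  eventually_ne_cobounded 0

lemma isBigO_one_id : (fun _ => (1 : ℂ)) =O[cobounded ℂ] fun t : ℂ => t :=
  (isLittleO_const_id_cobounded (1 : ℂ)).isBigO

/-- Cancellation of a common factor bounded below. -/
lemma isBigO_of_mul_isBigO_mul {l : Filter ℂ} {a u v w : ℂ → ℂ} (ha : ∀ᶠ t in l, a t ≠ 0)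
    (hau : a =O[l] u) (h : (fun t => u t * v t) =O[l] fun t => a t * w t) : v =O[l] w := by
  have h' : (fun t => (a t)⁻¹ * (a t * v t)) =O[l] fun t => (a t)⁻¹ * (a t * w t) :=
    (isBigO_refl _ l).mul ((hau.mul (isBigO_refl v l)).trans h)
  refine h'.congr' ?_ ?_
  all_goals
    filter_upwards [ha] with t ht
    rw [inv_mul_cancel_left₀ ht]

/-- A solution of `A₅(α)` with poles at infinity exactly in the components `0, 1, 2, 3`. -/
structure IsTypeBSolution (α : Fin 6 → ℂ) (f : Fin 6 → RatFunc ℂ) : Prop where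
  sol : IsA5Solution α f
  pole0 : PoleAtInfty (f 0)
  pole1 : PoleAtInfty (f 1)
  pole2 : PoleAtInfty (f 2)
  pole3 : PoleAtInfty (f 3)
  holo4 : HoloAtInfty (f 4)
  holo5 : HoloAtInfty (f 5)

lemma eventually_evalR_add_add_eq_id {f g h : RatFunc ℂ} (hsum : f + g + h = RatFunc.X) :
    ∀ᶠ t in cobounded ℂ, evalR f t + evalR g t + evalR h t = t := by
  filter_upwards [eventually_definedAt f, eventually_definedAt g, eventually_definedAt h,
    eventually_definedAt (f + g)] with t hf hg hh hfg
  rw [← evalR_add hf hg, ← evalR_add hfg hh, hsum]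
  simp [evalR]

/-- The logarithmic growth rate of the component `0`, up to a constant. -/
def rate0 (f : Fin 6 → RatFunc ℂ) (t : ℂ) : ℂ :=
  evalR (f 2) t * (evalR (f 1) t - evalR (f 3) t - evalR (f 5) t)
    + evalR (f 4) t * (t - 2 * evalR (f 5) t)

/-- The logarithmic growth rate of the component `1`, up to a constant. -/
def rate1 (f : Fin 6 → RatFunc ℂ) (t : ℂ) : ℂ :=
  (evalR (f 3) t + evalR (f 5) t) * (evalR (f 2) t - evalR (f 0) t)
    + (evalR (f 5) t - evalR (f 3) t) * evalR (f 4) t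

/-- The logarithmic growth rate of the component `4`, up to a constant. -/
def rate4 (f : Fin 6 → RatFunc ℂ) (t : ℂ) : ℂ :=
  evalR (f 5) t * (evalR (f 0) t + evalR (f 2) t)
    + evalR (f 1) t * (evalR (f 2) t - evalR (f 0) t)
    - (evalR (f 0) t + evalR (f 2) t) * evalR (f 3) t

/-- The logarithmic growth rate of the component `5`, up to a constant. -/
def rate5 (f : Fin 6 → RatFunc ℂ) (t : ℂ) : ℂ :=
  evalR (f 0) t * (evalR (f 1) t + evalR (f 3) t)
    + evalR (f 2) t * (evalR (f 3) t - evalR (f 1) t)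
    - (evalR (f 1) t + evalR (f 3) t) * evalR (f 4) t

namespace IsTypeBSolution

variable {α : Fin 6 → ℂ} {f : Fin 6 → RatFunc ℂ}

lemma eventually_even (h : IsTypeBSolution α f) :
    ∀ᶠ t in cobounded ℂ, evalR (f 0) t + evalR (f 2) t + evalR (f 4) t = t :=
  eventually_evalR_add_add_eq_id h.sol.1

lemma eventually_odd (h : IsTypeBSolution α f) :
    ∀ᶠ t in cobounded ℂ, evalR (f 1) t + evalR (f 3) t + evalR (f 5) t = t :=
  eventually_evalR_add_add_eq_id h.sol.2.1

lemma eventually_defined (f : Fin 6 → RatFunc ℂ) :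
    ∀ᶠ t in cobounded ℂ, ∀ j, DefinedAt (f j) t :=
  eventually_all.mpr fun j => eventually_definedAt (f j)

lemma eventually_ode0 (h : IsTypeBSolution α f) : ∀ᶠ t in cobounded ℂ,
    t / 2 * deriv (evalR (f 0)) t = evalR (f 0) t * rate0 f t
      + (1 / 2 - α 2 - α 4) * evalR (f 0) t + α 0 * (evalR (f 2) t + evalR (f 4) t) := by
  filter_upwards [eventually_defined f, h.eventually_odd] with t ht hodd
  refine (h.sol.2.2 t ht 0).trans ?_
  simp only [rate0, Fin.isValue, Fin.reduceAdd]
  linear_combination (evalR (f 0) t * evalR (f 4) t) * hodd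

lemma eventually_ode1 (h : IsTypeBSolution α f) : ∀ᶠ t in cobounded ℂ,
    t / 2 * deriv (evalR (f 1)) t = evalR (f 1) t * rate1 f t
      + (1 / 2 - α 3 - α 5) * evalR (f 1) t + α 1 * (evalR (f 3) t + evalR (f 5) t) := by
  filter_upwards [eventually_defined f] with t ht
  refine (h.sol.2.2 t ht 1).trans ?_
  simp only [rate1, Fin.isValue, Fin.reduceAdd]
  ring

lemma eventually_ode4 (h : IsTypeBSolution α f) : ∀ᶠ t in cobounded ℂ,
    t / 2 * deriv (evalR (f 4)) t = evalR (f 4) t * rate4 f t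
      + (1 / 2 - α 0 - α 2) * evalR (f 4) t + α 4 * (evalR (f 0) t + evalR (f 2) t) := by
  filter_upwards [eventually_defined f] with t ht
  refine (h.sol.2.2 t ht 4).trans ?_
  simp only [rate4, Fin.isValue, Fin.reduceAdd]
  ring

lemma eventually_ode5 (h : IsTypeBSolution α f) : ∀ᶠ t in cobounded ℂ,
    t / 2 * deriv (evalR (f 5)) t = evalR (f 5) t * rate5 f t
      + (1 / 2 - α 1 - α 3) * evalR (f 5) t + α 5 * (evalR (f 1) t + evalR (f 3) t) := by
  filter_upwards [eventually_defined f] with t ht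
  refine (h.sol.2.2 t ht 5).trans ?_
  simp only [rate5, Fin.isValue, Fin.reduceAdd]
  ring

/-- If `u` grows at least linearly and solves `e = u * A + c * u + a * s` with `e` and `s` bounded
by `u`, then the rate `A` is bounded. -/
lemma isBigO_one_of_ode {u e A s : ℂ → ℂ} {c a : ℂ}
    (hu : (fun t : ℂ => t) =O[cobounded ℂ] u) (he : e =O[cobounded ℂ] u)
    (hs : s =O[cobounded ℂ] u)
    (hode : ∀ᶠ t in cobounded ℂ, e t = u t * A t + c * u t + a * s t) :
    A =O[cobounded ℂ] fun _ => (1 : ℂ) := by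
  have hne : ∀ᶠ t in cobounded ℂ, u t ≠ 0 := by
    filter_upwards [hu.eq_zero_imp, eventually_id_ne_zero] with t h₁ h₂ h₃ using h₂ (h₁ h₃)
  refine isBigO_of_mul_isBigO_mul hne (isBigO_refl u _) ?_
  simp only [mul_one]
  refine ((he.sub ((isBigO_refl u _).const_mul_left c)).sub (hs.const_mul_left a)).congr' ?_
    EventuallyEq.rfl
  filter_upwards [hode] with t ht
  linear_combination ht

lemma rate0_isBigO (h : IsTypeBSolution α f) :
    rate0 f =O[cobounded ℂ] fun _ => (1 : ℂ) := by
  refine isBigO_one_of_ode h.pole0.isBigO_id (isBigO_id_mul_deriv_evalR _) ?_ h.eventually_ode0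
  refine (h.pole0.isBigO_id.sub (isBigO_refl (evalR (f 0)) _)).congr' ?_ EventuallyEq.rfl
  filter_upwards [h.eventually_even] with t ht
  linear_combination -ht

lemma rate1_isBigO (h : IsTypeBSolution α f) :
    rate1 f =O[cobounded ℂ] fun _ => (1 : ℂ) := by
  refine isBigO_one_of_ode h.pole1.isBigO_id (isBigO_id_mul_deriv_evalR _) ?_ h.eventually_ode1
  refine (h.pole1.isBigO_id.sub (isBigO_refl (evalR (f 1)) _)).congr' ?_ EventuallyEq.rfl
  filter_upwards [h.eventually_odd] with t ht
  linear_combination -ht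

lemma isBigO_id_of_holo {g : RatFunc ℂ} (hg : HoloAtInfty g) :
    evalR g =O[cobounded ℂ] fun t => t :=
  hg.isBigO_one.trans isBigO_one_id

lemma odd_gap_isBigO (h : IsTypeBSolution α f) :
    (fun t => evalR (f 1) t - evalR (f 3) t - evalR (f 5) t)
      =O[cobounded ℂ] fun _ => (1 : ℂ) := by
  refine isBigO_of_mul_isBigO_mul eventually_id_ne_zero h.pole2.isBigO_id ?_
  have h₁ : (fun t => evalR (f 4) t * (t - 2 * evalR (f 5) t))
      =O[cobounded ℂ] fun t => 1 * t :=
    h.holo4.isBigO_one.mul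
      ((isBigO_refl _ _).sub ((isBigO_id_of_holo h.holo5).const_mul_left 2))
  simp only [one_mul] at h₁
  simp only [mul_one]
  refine ((h.rate0_isBigO.trans isBigO_one_id).sub h₁).congr_left fun t => ?_
  simp only [rate0]
  ring

lemma sub_half1_isBigO (h : IsTypeBSolution α f) :
    (fun t => evalR (f 1) t - t / 2) =O[cobounded ℂ] fun _ => (1 : ℂ) := by
  refine (h.odd_gap_isBigO.const_mul_left (1 / 2)).congr' ?_ EventuallyEq.rfl
  filter_upwards [h.eventually_odd] with t ht
  linear_combination (-1 / 2) * ht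

lemma sub_half3_isBigO (h : IsTypeBSolution α f) :
    (fun t => evalR (f 3) t - t / 2) =O[cobounded ℂ] fun _ => (1 : ℂ) := by
  refine ((h.sub_half1_isBigO.add h.holo5.isBigO_one).const_mul_left (-1)).congr' ?_
    EventuallyEq.rfl
  filter_upwards [h.eventually_odd] with t ht
  linear_combination -ht

lemma isBigO_id_of_sub_half {u : ℂ → ℂ}
    (hu : (fun t => u t - t / 2) =O[cobounded ℂ] fun _ => (1 : ℂ)) :
    u =O[cobounded ℂ] fun t => t :=
  ((hu.trans isBigO_one_id).add
    ((isBigO_refl (fun t : ℂ => t) _).const_mul_left (1 / 2))).congr_left fun t => by ring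

lemma id_isBigO_add35 (h : IsTypeBSolution α f) :
    (fun t : ℂ => t) =O[cobounded ℂ] fun t => evalR (f 3) t + evalR (f 5) t := by
  have h₁ : (fun t => evalR (f 3) t - t / 2 + evalR (f 5) t)
      =o[cobounded ℂ] fun t : ℂ => t / 2 := by
    refine (h.sub_half3_isBigO.add h.holo5.isBigO_one).trans_isLittleO ?_
    refine ((isLittleO_const_id_cobounded (1 : ℂ)).const_mul_right
      (c := (1 / 2 : ℂ)) (by norm_num)).congr_right fun t => ?_
    simp only [id]
    ring
  have h₂ := h₁.right_isBigO_add
  have h₃ : (fun t : ℂ => t) =O[cobounded ℂ] fun t : ℂ => t / 2 :=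
    ((isBigO_refl (fun t : ℂ => t / 2) _).const_mul_left 2).congr_left fun t => by ring
  refine (h₃.trans h₂).congr_right fun t => ?_
  ring

lemma even_gap_isBigO (h : IsTypeBSolution α f) :
    (fun t => evalR (f 2) t - evalR (f 0) t) =O[cobounded ℂ] fun _ => (1 : ℂ) := by
  refine isBigO_of_mul_isBigO_mul eventually_id_ne_zero h.id_isBigO_add35 ?_
  have h₁ : (fun t => (evalR (f 5) t - evalR (f 3) t) * evalR (f 4) t)
      =O[cobounded ℂ] fun t => t * 1 :=
    ((isBigO_id_of_holo h.holo5).sub (isBigO_id_of_sub_half h.sub_half3_isBigO)).mul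
      h.holo4.isBigO_one
  simp only [mul_one] at h₁ ⊢
  refine ((h.rate1_isBigO.trans isBigO_one_id).sub h₁).congr_left fun t => ?_
  simp only [rate1]
  ring

lemma sub_half0_isBigO (h : IsTypeBSolution α f) :
    (fun t => evalR (f 0) t - t / 2) =O[cobounded ℂ] fun _ => (1 : ℂ) := by
  refine ((h.even_gap_isBigO.add h.holo4.isBigO_one).const_mul_left (-1 / 2)).congr' ?_
    EventuallyEq.rfl
  filter_upwards [h.eventually_even] with t ht
  linear_combination (-1 / 2) * ht

lemma sub_half2_isBigO (h : IsTypeBSolution α f) :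
    (fun t => evalR (f 2) t - t / 2) =O[cobounded ℂ] fun _ => (1 : ℂ) :=
  (h.even_gap_isBigO.add h.sub_half0_isBigO).congr_left fun t => by ring

/-- Every component grows at most linearly. -/
lemma isBigO_id (h : IsTypeBSolution α f) (j : Fin 6) :
    evalR (f j) =O[cobounded ℂ] fun t => t := by
  fin_cases j
  · exact isBigO_id_of_sub_half h.sub_half0_isBigO
  · exact isBigO_id_of_sub_half h.sub_half1_isBigO
  · exact isBigO_id_of_sub_half h.sub_half2_isBigO
  · exact isBigO_id_of_sub_half h.sub_half3_isBigO
  · exact isBigO_id_of_holo h.holo4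
  · exact isBigO_id_of_holo h.holo5

lemma rate4_add_sq_isBigO (h : IsTypeBSolution α f) :
    (fun t => rate4 f t + t ^ 2 / 2) =O[cobounded ℂ] fun t => t := by
  have h₁ := h.holo5.isBigO_one.mul ((h.isBigO_id 0).add (h.isBigO_id 2))
  have h₂ := h.even_gap_isBigO.mul (h.isBigO_id 1)
  have h₃ := h.holo4.isBigO_one.mul (h.isBigO_id 3)
  have h₄ := h.sub_half3_isBigO.mul (isBigO_refl (fun t : ℂ => t) (cobounded ℂ))
  simp only [one_mul] at h₁ h₂ h₃ h₄
  refine (((h₁.add h₂).add h₃).sub h₄).congr' ?_ EventuallyEq.rfl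
  filter_upwards [h.eventually_even] with t ht
  simp only [rate4]
  linear_combination evalR (f 3) t * ht

lemma rate5_sub_sq_isBigO (h : IsTypeBSolution α f) :
    (fun t => rate5 f t - t ^ 2 / 2) =O[cobounded ℂ] fun t => t := by
  have h₁ := h.holo4.isBigO_one.mul ((h.isBigO_id 1).add (h.isBigO_id 3))
  have h₂ := (h.odd_gap_isBigO.add h.holo5.isBigO_one).mul (h.isBigO_id 2)
  have h₃ := h.holo5.isBigO_one.mul (h.isBigO_id 0)
  have h₄ := h.sub_half0_isBigO.mul (isBigO_refl (fun t : ℂ => t) (cobounded ℂ))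
  simp only [one_mul] at h₁ h₂ h₃ h₄
  refine (((h₄.sub h₁).sub h₂).sub h₃).congr' ?_ EventuallyEq.rfl
  filter_upwards [h.eventually_odd] with t ht
  simp only [rate5]
  linear_combination -evalR (f 0) t * ht

end IsTypeBSolution

/-- The total size of the difference of two tuples of rational functions. -/
def totalDiff (f g : Fin 6 → RatFunc ℂ) (t : ℂ) : ℂ :=
  ((∑ j, ‖evalR (f j) t - evalR (g j) t‖ : ℝ) : ℂ)

lemma norm_totalDiff (f g : Fin 6 → RatFunc ℂ) (t : ℂ) :
    ‖totalDiff f g t‖ = ∑ j, ‖evalR (f j) t - evalR (g j) t‖ := by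
  rw [totalDiff, Complex.norm_real, Real.norm_of_nonneg]
  exact Finset.sum_nonneg fun j _ => norm_nonneg _

lemma sub_isBigO_totalDiff (f g : Fin 6 → RatFunc ℂ) (j : Fin 6) :
    (fun t => evalR (f j) t - evalR (g j) t) =O[cobounded ℂ] totalDiff f g := by
  refine IsBigO.of_bound 1 (Eventually.of_forall fun t => ?_)
  rw [one_mul, norm_totalDiff]
  exact Finset.single_le_sum (f := fun j => ‖evalR (f j) t - evalR (g j) t‖)
    (fun j _ => norm_nonneg _) (Finset.mem_univ j)

lemma euler_sub_isBigO_totalDiff (f g : Fin 6 → RatFunc ℂ) (j : Fin 6) :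
    (fun t => t / 2 * deriv (evalR (f j)) t - t / 2 * deriv (evalR (g j)) t)
      =O[cobounded ℂ] totalDiff f g := by
  refine IsBigO.trans ?_ (sub_isBigO_totalDiff f g j)
  refine (isBigO_id_mul_deriv_evalR (f j - g j)).congr' ?_ (evalR_sub_eventually _ _)
  filter_upwards [deriv_evalR_sub_eventually (f j) (g j)] with t ht
  rw [ht, mul_sub]

lemma totalDiff_isBigO_mul (f g : Fin 6 → RatFunc ℂ) :
    totalDiff f g =O[cobounded ℂ] fun t => t * totalDiff f g t := by
  simpa using isBigO_one_id.mul (isBigO_refl (totalDiff f g) _)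

/-- If multiplication by `t` does not increase the growth of any difference beyond the total
difference, then the tuples coincide. -/
lemma eq_of_mul_sub_isBigO_totalDiff {f g : Fin 6 → RatFunc ℂ}
    (h : ∀ j, (fun t => t * (evalR (f j) t - evalR (g j) t)) =O[cobounded ℂ] totalDiff f g)
    (j : Fin 6) : f j = g j := by
  have h₁ : (fun t => t * totalDiff f g t) =O[cobounded ℂ] totalDiff f g := by
    have h₂ : (fun t => ∑ j, ‖t * (evalR (f j) t - evalR (g j) t)‖)
        =O[cobounded ℂ] totalDiff f g := IsBigO.fun_sum fun j _ => (h j).norm_left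
    refine (IsBigO.of_bound 1 (Eventually.of_forall fun t => ?_)).trans h₂
    rw [one_mul, norm_mul, norm_totalDiff, Finset.mul_sum]
    simp only [norm_mul]
    exact le_abs_self _
  have h₂ : totalDiff f g =o[cobounded ℂ] totalDiff f g := by
    refine IsLittleO.trans_isBigO ?_ h₁
    simpa using (isLittleO_const_id_cobounded (1 : ℂ)).mul_isBigO
      (isBigO_refl (totalDiff f g) _)
  have h₃ : ∀ᶠ t in cobounded ℂ, totalDiff f g t = 0 := by
    by_contra hne
    exact isLittleO_irrefl (not_eventually.mp hne) h₂
  rw [← sub_eq_zero]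
  refine eq_zero_of_evalR_eventually_eq_zero ?_
  filter_upwards [h₃, evalR_sub_eventually (f j) (g j), (sub_isBigO_totalDiff f g j).eq_zero_imp]
    with t k₁ k₂ k₃
  rw [k₂, k₃ k₁]

namespace IsTypeBSolution

variable {α : Fin 6 → ℂ} {f g : Fin 6 → RatFunc ℂ}

lemma mul_sub_isBigO (h : IsTypeBSolution α f) (f' g' : Fin 6 → RatFunc ℂ) (j k : Fin 6) :
    (fun t => evalR (f j) t * (evalR (f' k) t - evalR (g' k) t))
      =O[cobounded ℂ] fun t => t * totalDiff f' g' t :=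
  (h.isBigO_id j).mul (sub_isBigO_totalDiff f' g' k)

lemma rate4_sub_isBigO (hf : IsTypeBSolution α f) (hg : IsTypeBSolution α g) :
    (fun t => rate4 f t - rate4 g t) =O[cobounded ℂ] fun t => t * totalDiff f g t := by
  have F := hf.mul_sub_isBigO f g
  have G := hg.mul_sub_isBigO f g
  refine ((((((((((((F 0 5).add (F 2 5)).add (G 5 0)).add (G 5 2)).add (F 2 1)).sub (F 0 1)).add
    (G 1 2)).sub (G 1 0)).sub (F 3 0)).sub (F 3 2)).sub (G 0 3)).sub (G 2 3)).congr_left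
    fun t => ?_
  simp only [rate4]
  ring

lemma rate5_sub_isBigO (hf : IsTypeBSolution α f) (hg : IsTypeBSolution α g) :
    (fun t => rate5 f t - rate5 g t) =O[cobounded ℂ] fun t => t * totalDiff f g t := by
  have F := hf.mul_sub_isBigO f g
  have G := hg.mul_sub_isBigO f g
  refine ((((((((((((F 1 0).add (F 3 0)).add (G 0 1)).add (G 0 3)).add (F 3 2)).sub (F 1 2)).add
    (G 2 3)).sub (G 2 1)).sub (F 4 1)).sub (F 4 3)).sub (G 1 4)).sub (G 3 4)).congr_left
    fun t => ?_
  simp only [rate5]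
  ring

/-- A bounded component whose rate is asymptotic to `σ * t ^ 2 / 2` with `σ ^ 2 = 1` has a
difference smaller than the total difference by a factor `t`. -/
lemma mul_sub_isBigO_of_rate {A B s : ℂ → ℂ} {c a σ : ℂ} (j : Fin 6) (hσ : σ ^ 2 = 1)
    (hA : (fun t => A t - σ * (t ^ 2 / 2)) =O[cobounded ℂ] fun t => t)
    (hAB : (fun t => A t - B t) =O[cobounded ℂ] fun t => t * totalDiff f g t)
    (hgj : evalR (g j) =O[cobounded ℂ] fun _ => (1 : ℂ))
    (hs : s =O[cobounded ℂ] totalDiff f g)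
    (hode : ∀ᶠ t in cobounded ℂ,
      t / 2 * deriv (evalR (f j)) t - t / 2 * deriv (evalR (g j)) t
        = evalR (f j) t * A t - evalR (g j) t * B t + c * (evalR (f j) t - evalR (g j) t)
          + a * s t) :
    (fun t => t * (evalR (f j) t - evalR (g j) t)) =O[cobounded ℂ] totalDiff f g := by
  refine isBigO_of_mul_isBigO_mul eventually_id_ne_zero (isBigO_refl _ _) ?_
  have hD := totalDiff_isBigO_mul f g
  have hd := sub_isBigO_totalDiff f g j
  have h₁ := hgj.mul hAB
  simp only [one_mul] at h₁
  refine ((((((euler_sub_isBigO_totalDiff f g j).trans hD).sub (hA.mul hd)).sub h₁).sub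
    ((hd.trans hD).const_mul_left c)).sub ((hs.trans hD).const_mul_left a)).const_mul_left
    (2 * σ) |>.congr' ?_ EventuallyEq.rfl
  filter_upwards [hode] with t ht
  linear_combination (2 * σ) * ht + t ^ 2 * (evalR (f j) t - evalR (g j) t) * hσ

lemma mul_sub4_isBigO (hf : IsTypeBSolution α f) (hg : IsTypeBSolution α g) :
    (fun t => t * (evalR (f 4) t - evalR (g 4) t)) =O[cobounded ℂ] totalDiff f g := by
  refine mul_sub_isBigO_of_rate (σ := -1) (c := 1 / 2 - α 0 - α 2) (a := α 4) 4 (by norm_num)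
    (hf.rate4_add_sq_isBigO.congr_left fun t => by ring) (hf.rate4_sub_isBigO hg)
    hg.holo4.isBigO_one ((sub_isBigO_totalDiff f g 0).add (sub_isBigO_totalDiff f g 2)) ?_
  filter_upwards [hf.eventually_ode4, hg.eventually_ode4] with t h₁ h₂
  linear_combination h₁ - h₂

lemma mul_sub5_isBigO (hf : IsTypeBSolution α f) (hg : IsTypeBSolution α g) :
    (fun t => t * (evalR (f 5) t - evalR (g 5) t)) =O[cobounded ℂ] totalDiff f g := by
  refine mul_sub_isBigO_of_rate (σ := 1) (c := 1 / 2 - α 1 - α 3) (a := α 5) 5 (by norm_num)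
    (hf.rate5_sub_sq_isBigO.congr_left fun t => by ring) (hf.rate5_sub_isBigO hg)
    hg.holo5.isBigO_one ((sub_isBigO_totalDiff f g 1).add (sub_isBigO_totalDiff f g 3)) ?_
  filter_upwards [hf.eventually_ode5, hg.eventually_ode5] with t h₁ h₂
  linear_combination h₁ - h₂

/-- If a component has a pole and bounded rate, then the differences of its rates are bounded by
the total difference. -/
lemma rate_sub_isBigO_of_pole {A B s : ℂ → ℂ} {c a : ℂ} (j : Fin 6)
    (hA : A =O[cobounded ℂ] fun _ => (1 : ℂ))
    (hgj : (fun t : ℂ => t) =O[cobounded ℂ] evalR (g j))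
    (hs : s =O[cobounded ℂ] totalDiff f g)
    (hode : ∀ᶠ t in cobounded ℂ,
      t / 2 * deriv (evalR (f j)) t - t / 2 * deriv (evalR (g j)) t
        = evalR (f j) t * A t - evalR (g j) t * B t + c * (evalR (f j) t - evalR (g j) t)
          + a * s t) :
    (fun t => A t - B t) =O[cobounded ℂ] totalDiff f g := by
  refine isBigO_of_mul_isBigO_mul eventually_id_ne_zero hgj ?_
  have hd := sub_isBigO_totalDiff f g j
  have h₁ := hA.mul hd
  simp only [one_mul] at h₁
  refine (((((euler_sub_isBigO_totalDiff f g j).sub h₁).sub (hd.const_mul_left c)).sub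
    (hs.const_mul_left a)).trans (totalDiff_isBigO_mul f g)).congr' ?_ EventuallyEq.rfl
  filter_upwards [hode] with t ht
  linear_combination ht

lemma mul_sub1_isBigO (hf : IsTypeBSolution α f) (hg : IsTypeBSolution α g) :
    (fun t => t * (evalR (f 1) t - evalR (g 1) t)) =O[cobounded ℂ] totalDiff f g := by
  have hrate : (fun t => rate0 f t - rate0 g t) =O[cobounded ℂ] totalDiff f g := by
    refine rate_sub_isBigO_of_pole (c := 1 / 2 - α 2 - α 4) (a := α 0) 0 hf.rate0_isBigO
      hg.pole0.isBigO_id ((sub_isBigO_totalDiff f g 2).add (sub_isBigO_totalDiff f g 4)) ?_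
    filter_upwards [hf.eventually_ode0, hg.eventually_ode0] with t h₁ h₂
    linear_combination h₁ - h₂
  have d := sub_isBigO_totalDiff f g
  have h₁ := hf.odd_gap_isBigO.mul (d 2)
  have h₂ := hf.holo5.isBigO_one.mul (d 4)
  have h₃ := hg.holo4.isBigO_one.mul (d 5)
  simp only [one_mul] at h₁ h₂ h₃
  refine ((hg.pole2.isBigO_id.mul (isBigO_refl _ _)).trans ?_ :
    (fun t => t * (evalR (f 1) t - evalR (g 1) t)) =O[cobounded ℂ] totalDiff f g)
  refine ((((hrate.sub h₁).sub (hf.mul_sub4_isBigO hg)).add (h₂.const_mul_left 2)).add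
    (h₃.const_mul_left 2)).const_mul_left (1 / 2) |>.congr' ?_ EventuallyEq.rfl
  filter_upwards [hf.eventually_odd, hg.eventually_odd] with t k₁ k₂
  simp only [rate0]
  linear_combination (-1 / 2) * evalR (g 2) t * (k₁ - k₂)

lemma mul_sub_even_gap_isBigO (hf : IsTypeBSolution α f) (hg : IsTypeBSolution α g) :
    (fun t => t * ((evalR (f 2) t - evalR (g 2) t) - (evalR (f 0) t - evalR (g 0) t)))
      =O[cobounded ℂ] totalDiff f g := by
  have hrate : (fun t => rate1 f t - rate1 g t) =O[cobounded ℂ] totalDiff f g := by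
    refine rate_sub_isBigO_of_pole (c := 1 / 2 - α 3 - α 5) (a := α 1) 1 hf.rate1_isBigO
      hg.pole1.isBigO_id ((sub_isBigO_totalDiff f g 3).add (sub_isBigO_totalDiff f g 5)) ?_
    filter_upwards [hf.eventually_ode1, hg.eventually_ode1] with t h₁ h₂
    linear_combination h₁ - h₂
  have d := sub_isBigO_totalDiff f g
  have h₁ := hf.even_gap_isBigO.mul ((d 3).add (d 5))
  have h₂ := hf.holo4.isBigO_one.mul ((d 5).sub (d 3))
  simp only [one_mul] at h₁ h₂
  have h₃ : (fun t => (evalR (g 5) t - evalR (g 3) t) * (evalR (f 4) t - evalR (g 4) t))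
      =O[cobounded ℂ] totalDiff f g :=
    (((hg.isBigO_id 5).sub (hg.isBigO_id 3)).mul (isBigO_refl _ _)).trans
      (hf.mul_sub4_isBigO hg)
  refine (hg.id_isBigO_add35.mul (isBigO_refl _ _)).trans ?_
  refine (((hrate.sub h₁).sub h₂).sub h₃).congr_left fun t => ?_
  simp only [rate1]
  ring

lemma unique (hf : IsTypeBSolution α f) (hg : IsTypeBSolution α g) (j : Fin 6) : f j = g j := by
  have h₁ := hf.mul_sub1_isBigO hg
  have h₄ := hf.mul_sub4_isBigO hg
  have h₅ := hf.mul_sub5_isBigO hg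
  have h₂₀ := hf.mul_sub_even_gap_isBigO hg
  refine eq_of_mul_sub_isBigO_totalDiff (fun k => ?_) j
  fin_cases k
  · refine ((h₂₀.add h₄).const_mul_left (-1 / 2)).congr' ?_ EventuallyEq.rfl
    filter_upwards [hf.eventually_even, hg.eventually_even] with t k₁ k₂
    simp only [Fin.isValue, Fin.zero_eta]
    linear_combination (-1 / 2) * t * (k₁ - k₂)
  · exact h₁
  · refine ((h₂₀.sub h₄).const_mul_left (1 / 2)).congr' ?_ EventuallyEq.rfl
    filter_upwards [hf.eventually_even, hg.eventually_even] with t k₁ k₂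
    simp only [Fin.isValue, Fin.reduceFinMk]
    linear_combination (-1 / 2) * t * (k₁ - k₂)
  · refine ((h₁.add h₅).const_mul_left (-1)).congr' ?_ EventuallyEq.rfl
    filter_upwards [hf.eventually_odd, hg.eventually_odd] with t k₁ k₂
    simp only [Fin.isValue, Fin.reduceFinMk]
    linear_combination -t * (k₁ - k₂)
  · exact h₄
  · exact h₅

end IsTypeBSolution

/-- The system is invariant under simultaneous rotation of parameters and components. -/
lemma IsA5Solution.rotate {α : Fin 6 → ℂ} {f : Fin 6 → RatFunc ℂ} (h : IsA5Solution α f)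
    (i : Fin 6) : IsA5Solution (fun j => α (i + j)) fun j => f (i + j) := by
  obtain ⟨heven, hodd, hode⟩ := h
  refine ⟨?_, ?_, fun t ht j => ?_⟩
  · fin_cases i <;> simp only [Fin.isValue, Fin.reduceFinMk, Fin.reduceAdd] <;>
      first | linear_combination heven | linear_combination hodd
  · fin_cases i <;> simp only [Fin.isValue, Fin.reduceFinMk, Fin.reduceAdd] <;>
      first | linear_combination heven | linear_combination hodd
  · have hdef : ∀ k, DefinedAt (f k) t := fun k => by simpa using ht (k - i)
    simpa only [add_assoc] using hode t hdef (i + j)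

/-- Uniqueness of a Type B rational solution with a given pole configuration. -/
theorem stmt_8 (α : Fin 6 → ℂ) (i : Fin 6)
    (hsum : α 0 + α 1 + α 2 + α 3 + α 4 + α 5 = 1)
    (f g : Fin 6 → RatFunc ℂ)
    (hf : IsA5Solution α f) (hg : IsA5Solution α g)
    (hfpi : PoleAtInfty (f i)) (hfpi1 : PoleAtInfty (f (i + 1)))
    (hfpi2 : PoleAtInfty (f (i + 2))) (hfpi3 : PoleAtInfty (f (i + 3)))
    (hfh4 : HoloAtInfty (f (i + 4))) (hfh5 : HoloAtInfty (f (i + 5)))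
    (hgpi : PoleAtInfty (g i)) (hgpi1 : PoleAtInfty (g (i + 1)))
    (hgpi2 : PoleAtInfty (g (i + 2))) (hgpi3 : PoleAtInfty (g (i + 3)))
    (hgh4 : HoloAtInfty (g (i + 4))) (hgh5 : HoloAtInfty (g (i + 5))) :
    ∀ j : Fin 6, f j = g j := by
  intro j
  have hF : IsTypeBSolution (fun k => α (i + k)) fun k => f (i + k) :=
    ⟨hf.rotate i, by simpa using hfpi, hfpi1, hfpi2, hfpi3, hfh4, hfh5⟩
  have hG : IsTypeBSolution (fun k => α (i + k)) fun k => g (i + k) :=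
    ⟨hg.rotate i, by simpa using hgpi, hgpi1, hgpi2, hgpi3, hgh4, hgh5⟩
  simpa using hF.unique hG (j - i)
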